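/- arXiv:2001.00382 — 2 statements merged into one kernel-verified Lean document; each statement's English description precedes it below -/
import Mathlib

section
/- Let Φ be a Euclidean ring and let z ∈ Φ be a nonzero non-unit. The automorphism δ = (x_1 + [z x_1 − [x_2,x_3], x_3], x_2 + z(z x_1 − [x_2,x_3]), x_3) of the free Lie algebra L_3(Φ) = L_Φ⟨x_1,x_2,x_3⟩ is wild, i.e., δ does not belong to the subgroup generated by elementary automorphisms. -/
/-- The group structure (under composition) on the Lie algebra automorphisms. -/
noncomputable instance lieAutGroup (Φ : Type*) [CommRing Φ] (L : Type*)
    [LieRing L] [LieAlgebra Φ L] : Group (L ≃ₗ⁅Φ⁆ L) where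
  mul e f := f.trans e
  one := LieEquiv.refl
  inv := LieEquiv.symm
  mul_assoc e f g := rfl
  one_mul e := rfl
  mul_one e := rfl
  inv_mul_cancel e := LieEquiv.ext fun x => e.symm_apply_apply x

/-- The free generators `x_1, x_2, x_3` of `L_3(Φ) = L_Φ⟨x_1,x_2,x_3⟩`. -/
noncomputable def xg (Φ : Type*) [CommRing Φ] (i : Fin 3) :
    FreeLieAlgebra Φ (Fin 3) :=
  FreeLieAlgebra.of Φ i

/-- A linear automorphism of `L_3(Φ)`: each generator is sent to a `Φ`-linear
combination of the generators (membership in `GL_3(Φ)`). -/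
def IsLinearAut (Φ : Type*) [CommRing Φ]
    (φ : FreeLieAlgebra Φ (Fin 3) ≃ₗ⁅Φ⁆ FreeLieAlgebra Φ (Fin 3)) : Prop :=
  ∀ i : Fin 3, φ (xg Φ i) ∈ Submodule.span Φ (Set.range (xg Φ))

/-- A triangular automorphism of `L_3(Φ)` (membership in `B_3(Φ)`):
`μ = (α₁x₁ + h(x₂,x₃), β₂x₂ + β₃x₃, γ₂x₂ + γ₃x₃)` with `α₁` and `β₂γ₃ - β₃γ₂`
units of `Φ` and `h` in the subalgebra generated by `x₂, x₃`. -/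
def IsTriangularAut (Φ : Type*) [CommRing Φ]
    (φ : FreeLieAlgebra Φ (Fin 3) ≃ₗ⁅Φ⁆ FreeLieAlgebra Φ (Fin 3)) : Prop :=
  ∃ (α₁ β₂ β₃ γ₂ γ₃ : Φ) (h : FreeLieAlgebra Φ (Fin 3)),
    IsUnit α₁ ∧ IsUnit (β₂ * γ₃ - β₃ * γ₂) ∧
    h ∈ LieSubalgebra.lieSpan Φ (FreeLieAlgebra Φ (Fin 3)) {xg Φ 1, xg Φ 2} ∧
    φ (xg Φ 0) = α₁ • xg Φ 0 + h ∧
    φ (xg Φ 1) = β₂ • xg Φ 1 + β₃ • xg Φ 2 ∧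
    φ (xg Φ 2) = γ₂ • xg Φ 1 + γ₃ • xg Φ 2

/-- Membership in the set `B₀ = {τ = (x₁ + h(x₂,x₃), x₂, x₃) : h ∈ [L₃(Φ),L₃(Φ)]}`. -/
def IsB0Aut (Φ : Type*) [CommRing Φ]
    (τ : FreeLieAlgebra Φ (Fin 3) ≃ₗ⁅Φ⁆ FreeLieAlgebra Φ (Fin 3)) : Prop :=
  ∃ h : FreeLieAlgebra Φ (Fin 3),
    h ∈ LieSubalgebra.lieSpan Φ (FreeLieAlgebra Φ (Fin 3)) {xg Φ 1, xg Φ 2} ∧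
    h ∈ LieAlgebra.derivedSeries Φ (FreeLieAlgebra Φ (Fin 3)) 1 ∧
    τ (xg Φ 0) = xg Φ 0 + h ∧ τ (xg Φ 1) = xg Φ 1 ∧ τ (xg Φ 2) = xg Φ 2

/-- An elementary automorphism of `L_3(Φ)`: for some `i`, it sends `x_i` to
`α • x_i + f` with `α` a unit of `Φ` and `f` in the subalgebra generated by the
other two generators, and fixes the other generators. -/
def IsElementaryAut (Φ : Type*) [CommRing Φ]
    (φ : FreeLieAlgebra Φ (Fin 3) ≃ₗ⁅Φ⁆ FreeLieAlgebra Φ (Fin 3)) : Prop :=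
  ∃ (i : Fin 3) (α : Φ) (f : FreeLieAlgebra Φ (Fin 3)), IsUnit α ∧
    f ∈ LieSubalgebra.lieSpan Φ (FreeLieAlgebra Φ (Fin 3)) (xg Φ '' {j | j ≠ i}) ∧
    φ (xg Φ i) = α • xg Φ i + f ∧ ∀ j : Fin 3, j ≠ i → φ (xg Φ j) = xg Φ j

/-- A tame automorphism of `L_3(Φ)`: an element of the subgroup generated by the
elementary automorphisms. -/
def IsTameAut (Φ : Type*) [CommRing Φ]
    (φ : FreeLieAlgebra Φ (Fin 3) ≃ₗ⁅Φ⁆ FreeLieAlgebra Φ (Fin 3)) : Prop :=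
  φ ∈ Subgroup.closure {ψ | IsElementaryAut Φ ψ}

/-- `A₀` is a system of representatives, containing the identity, of the left cosets
of `H(Φ) = GL₃(Φ) ∩ B₃(Φ)` in `GL₃(Φ)`. -/
def IsA0System (Φ : Type*) [CommRing Φ]
    (A0 : Set (FreeLieAlgebra Φ (Fin 3) ≃ₗ⁅Φ⁆ FreeLieAlgebra Φ (Fin 3))) : Prop :=
  (1 ∈ A0) ∧ (∀ a ∈ A0, IsLinearAut Φ a) ∧
  (∀ σ, IsLinearAut Φ σ → ∃ a ∈ A0,
    IsLinearAut Φ (a⁻¹ * σ) ∧ IsTriangularAut Φ (a⁻¹ * σ)) ∧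
  (∀ a ∈ A0, ∀ a' ∈ A0, a ≠ a' →
    ¬ (IsLinearAut Φ (a⁻¹ * a') ∧ IsTriangularAut Φ (a⁻¹ * a')))

/-- A Euclidean ring structure on an integral domain `Φ` (which is not a field):
a norm `|·| : Φ\{0} → ℕ` with `|ab| ≥ |a|`, with equality iff `b` is a unit, and
division with remainder. -/
structure EuclideanRingStruct (Φ : Type*) [CommRing Φ] where
  nrm : Φ → ℕ
  nrm_le_nrm_mul : ∀ a b : Φ, a ≠ 0 → b ≠ 0 → nrm a ≤ nrm (a * b)
  nrm_mul_eq_iff : ∀ a b : Φ, a ≠ 0 → b ≠ 0 → (nrm (a * b) = nrm a ↔ IsUnit b)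
  division : ∀ a b : Φ, b ≠ 0 → ∃ q r : Φ, a = b * q + r ∧ (r = 0 ∨ nrm r < nrm b)
  not_field : ∃ a : Φ, a ≠ 0 ∧ ¬IsUnit a

section Words

variable {α : Type*}

theorem FreeMonoid.mul_ne_mul_of_not_commute (n : ℕ) : ∀ (u v : FreeMonoid α),
    u.length + v.length ≤ n → u * v ≠ v * u →
    ∀ a ∈ Submonoid.closure {u, v}, ∀ b ∈ Submonoid.closure {u, v}, u * a ≠ v * b := by
  induction n with
  | zero =>
    intro u v hn huv
    have hu : u.length = 0 := by omega
    rw [FreeMonoid.length_eq_zero] at hu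
    simp [hu] at huv
  | succ n ih =>
    have key : ∀ u v : FreeMonoid α, u.length + v.length ≤ n + 1 → u * v ≠ v * u →
        ∀ a ∈ Submonoid.closure {u, v}, ∀ b ∈ Submonoid.closure {u, v},
        ∀ c, v = u * c → u * a ≠ v * b := by
      rintro u _ hn huv a ha b hb c rfl h
      have hu : u.length ≠ 0 := by
        rw [Ne, FreeMonoid.length_eq_zero]; rintro rfl; simp at huv
      have hlen : u.length + c.length ≤ n := by
        rw [FreeMonoid.length_mul] at hn; omega
      have huc : u * c ≠ c * u := fun h' => huv (by rw [mul_assoc, ← h'])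
      have hsub : Submonoid.closure {u, u * c} ≤ Submonoid.closure {u, c} := by
        rw [Submonoid.closure_le]
        rintro x (rfl | rfl)
        · exact Submonoid.subset_closure (by simp)
        · exact mul_mem (Submonoid.subset_closure (by simp))
            (Submonoid.subset_closure (by simp))
      rw [mul_assoc] at h
      have h := mul_left_cancel h
      have hcases : a = 1 ∨ ∃ y ∈ Submonoid.closure {u, c}, a = u * y := by
        induction ha using Submonoid.closure_induction_left with
        | one => exact Or.inl rfl
        | mul_left x hx y hy _ =>
          rcases hx with rfl | rfl
          · exact Or.inr ⟨y, hsub hy, rfl⟩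
          · exact Or.inr ⟨c * y, mul_mem (Submonoid.subset_closure (by simp)) (hsub hy),
              by rw [mul_assoc]⟩
      rcases hcases with rfl | ⟨y, hy, rfl⟩
      · have hc : c = 1 := by
          have := congrArg FreeMonoid.length h
          rw [FreeMonoid.length_one, FreeMonoid.length_mul] at this
          rw [← FreeMonoid.length_eq_zero]; omega
        exact huc (by simp [hc])
      · exact ih u c hlen huc y hy b (hsub hb) h
    intro u v hn huv a ha b hb h
    rcases List.append_eq_append_iff.1 (show u.toList ++ a.toList = v.toList ++ b.toList from h)
      with ⟨c, hc, -⟩ | ⟨c, hc, -⟩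
    · exact key u v hn huv a ha b hb c hc h
    · rw [Set.pair_comm] at ha hb
      exact key v u (by omega) huv.symm b hb a ha c hc h.symm

theorem FreeMonoid.lift_mem_closure_pair (u v : FreeMonoid α) (w : FreeMonoid (Fin 2)) :
    FreeMonoid.lift ![u, v] w ∈ Submonoid.closure {u, v} := by
  induction w using FreeMonoid.inductionOn' with
  | one => simp
  | of_mul i w ih =>
    rw [map_mul, FreeMonoid.lift_eval_of]
    refine mul_mem (Submonoid.subset_closure ?_) ih
    fin_cases i <;> simp

/-- Two non-commuting words freely generate a free submonoid. -/
theorem FreeMonoid.lift_pair_injective {u v : FreeMonoid α} (huv : u * v ≠ v * u) :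
    Function.Injective (FreeMonoid.lift ![u, v]) := by
  have hne := FreeMonoid.mul_ne_mul_of_not_commute _ u v le_rfl huv
  have hu : u ≠ 1 := by rintro rfl; simp at huv
  have hv : v ≠ 1 := by rintro rfl; simp at huv
  have hone : ∀ (i : Fin 2) (w : FreeMonoid (Fin 2)),
      FreeMonoid.lift ![u, v] (FreeMonoid.of i * w) ≠ 1 := by
    intro i w h
    rw [map_mul, FreeMonoid.lift_eval_of] at h
    have h := congrArg FreeMonoid.length h
    rw [FreeMonoid.length_mul, FreeMonoid.length_one, Nat.add_eq_zero_iff,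
      FreeMonoid.length_eq_zero] at h
    fin_cases i
    exacts [hu h.1, hv h.1]
  intro w₁
  induction w₁ using FreeMonoid.inductionOn' with
  | one =>
    intro w₂ h
    cases w₂ using FreeMonoid.casesOn with
    | one => rfl
    | of_mul j w₂ => exact absurd h.symm (by simpa using hone j w₂)
  | of_mul i w₁ ih =>
    intro w₂ h
    cases w₂ using FreeMonoid.casesOn with
    | one => exact absurd h (by simpa using hone i w₁)
    | of_mul j w₂ =>
      rw [map_mul, map_mul, FreeMonoid.lift_eval_of, FreeMonoid.lift_eval_of] at h
      have h₁ := FreeMonoid.lift_mem_closure_pair u v w₁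
      have h₂ := FreeMonoid.lift_mem_closure_pair u v w₂
      fin_cases i <;> fin_cases j
      · rw [ih (mul_left_cancel h)]
      · exact absurd h (hne _ h₁ _ h₂)
      · exact absurd h.symm (hne _ h₂ _ h₁)
      · rw [ih (mul_left_cancel h)]

theorem FreeMonoid.not_mem_of_commute_of {β : Type*} {w : FreeMonoid β} {i : β}
    (h : w * FreeMonoid.of i = FreeMonoid.of i * w) : ∀ j ∈ w, j = i := by
  induction w using FreeMonoid.inductionOn' with
  | one => intro j hj; exact absurd hj FreeMonoid.notMem_one
  | of_mul a w ih =>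
    have h' : a :: (w.toList ++ [i]) = i :: (a :: w.toList) := h
    rw [List.cons.injEq] at h'
    obtain ⟨rfl, h'⟩ := h'
    intro j hj
    rcases FreeMonoid.mem_mul.1 hj with hj | hj
    · exact FreeMonoid.mem_of.1 hj
    · exact ih h' j hj

theorem FreeMonoid.length_add_le_of_mem (u v : FreeMonoid α) {w : FreeMonoid (Fin 2)}
    (h0 : 0 ∈ w) (h1 : 1 ∈ w) :
    u.length + v.length ≤ (FreeMonoid.lift ![u, v] w).length := by
  have key : ∀ (w : FreeMonoid (Fin 2)) (i : Fin 2), i ∈ w →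
      (![u, v] i).length ≤ (FreeMonoid.lift ![u, v] w).length := by
    intro w i hi
    induction w using FreeMonoid.inductionOn' with
    | one => exact absurd hi FreeMonoid.notMem_one
    | of_mul a w ih =>
      rw [map_mul, FreeMonoid.lift_eval_of, FreeMonoid.length_mul]
      rcases FreeMonoid.mem_mul.1 hi with hj | hj
      · rw [FreeMonoid.mem_of.1 hj]; omega
      · have := ih hj; omega
  induction w using FreeMonoid.inductionOn' with
  | one => exact absurd h0 FreeMonoid.notMem_one
  | of_mul a w ih =>
    rw [map_mul, FreeMonoid.lift_eval_of, FreeMonoid.length_mul]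
    rw [FreeMonoid.mem_mul, FreeMonoid.mem_of] at h0 h1
    fin_cases a
    · have := key w 1 (by simpa using h1)
      simpa using this
    · have := key w 0 (by simpa using h0)
      have h : u.length ≤ (FreeMonoid.lift ![u, v] w).length := this
      change _ ≤ v.length + _
      omega

end Words

section LeadingWord

variable {α : Type*}

/-- Words compared by this key are ordered by length first, and then lexicographically. -/
def wordKey (w : FreeMonoid α) : ℕ ×ₗ List α := toLex (w.length, w.toList)

theorem wordKey_injective : Function.Injective (wordKey (α := α)) := fun u v h => by
  simpa [wordKey] using congrArg (fun x => (ofLex x).2) h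

variable [LinearOrder α]

theorem wordKey_lt_iff {u v : FreeMonoid α} : wordKey u < wordKey v ↔
    u.length < v.length ∨ u.length = v.length ∧ u.toList < v.toList := Prod.Lex.toLex_lt_toLex

theorem List.append_lt_append_right_of_length_eq {s t : List α} (h : s.length = t.length)
    (hst : s < t) (r : List α) : s ++ r < t ++ r := by
  induction s generalizing t with
  | nil => simp_all [List.length_eq_zero_iff, eq_comm]
  | cons a s ih =>
    cases t with
    | nil => simp at h
    | cons b t =>
      simp only [List.cons_append, List.cons_lt_cons_iff] at hst ⊢
      rcases hst with hst | ⟨rfl, hst⟩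
      · exact Or.inl hst
      · exact Or.inr ⟨rfl, ih (by simpa using h) hst⟩

theorem wordKey_mul_lt_mul_left {u v : FreeMonoid α} (h : wordKey u < wordKey v)
    (w : FreeMonoid α) : wordKey (w * u) < wordKey (w * v) := by
  rw [wordKey_lt_iff] at h ⊢
  rcases h with h | ⟨h, h'⟩
  · exact Or.inl (by simpa using h)
  · refine Or.inr ⟨by simpa using h, ?_⟩
    exact List.Lex.append_left _ h' w.toList

theorem wordKey_mul_lt_mul_right {u v : FreeMonoid α} (h : wordKey u < wordKey v)
    (w : FreeMonoid α) : wordKey (u * w) < wordKey (v * w) := by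
  rw [wordKey_lt_iff] at h ⊢
  rcases h with h | ⟨h, h'⟩
  · exact Or.inl (by simpa using h)
  · exact Or.inr ⟨by simpa using h, List.append_lt_append_right_of_length_eq h h' _⟩

theorem length_le_of_wordKey_le {u v : FreeMonoid α} (h : wordKey u ≤ wordKey v) :
    u.length ≤ v.length := by
  rcases h.lt_or_eq with h | h
  · rcases wordKey_lt_iff.1 h with h | h
    exacts [h.le, h.1.le]
  · rw [wordKey_injective h]

theorem wordKey_lt_of_length_lt {u v : FreeMonoid α} (h : u.length < v.length) :
    wordKey u < wordKey v := wordKey_lt_iff.2 (Or.inl h)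

/-- `u` is the leading word of `p`. -/
def IsLeadingWord {K : Type*} [Semiring K] (p : MonoidAlgebra K (FreeMonoid α))
    (u : FreeMonoid α) : Prop :=
  p.coeff u ≠ 0 ∧ ∀ w, p.coeff w ≠ 0 → wordKey w ≤ wordKey u

namespace IsLeadingWord

theorem exists_of_ne_zero {K : Type*} [Semiring K] {p : MonoidAlgebra K (FreeMonoid α)}
    (hp : p ≠ 0) : ∃ u, IsLeadingWord p u := by
  have hne : p.coeff.support.Nonempty := by
    rw [Finsupp.support_nonempty_iff]; simpa using hp
  obtain ⟨u, hu, hmax⟩ := p.coeff.support.exists_max_image wordKey hne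
  exact ⟨u, by simpa using hu, fun w hw => hmax w (by simpa using hw)⟩

variable {K : Type*} [Field K] {p q : MonoidAlgebra K (FreeMonoid α)} {u v : FreeMonoid α}

theorem unique (h : IsLeadingWord p u) (h' : IsLeadingWord p v) : u = v :=
  wordKey_injective (le_antisymm (h'.2 _ h.1) (h.2 _ h'.1))

theorem coeff_eq_zero (h : IsLeadingWord p u) {w} (hw : wordKey u < wordKey w) :
    p.coeff w = 0 := by
  by_contra hne
  exact absurd (h.2 w hne) (not_le.2 hw)

theorem smul (h : IsLeadingWord p u) {c : K} (hc : c ≠ 0) : IsLeadingWord (c • p) u := by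
  refine ⟨by simpa [hc] using h.1, fun w hw => h.2 w fun h0 => hw (by simp [h0])⟩

theorem add_of_lt (h : IsLeadingWord p u)
    (hq : ∀ w, q.coeff w ≠ 0 → wordKey w < wordKey u) : IsLeadingWord (p + q) u := by
  have hqu : q.coeff u = 0 := by
    by_contra h0
    exact lt_irrefl _ (hq u h0)
  refine ⟨by simpa [hqu] using h.1, fun w hw => ?_⟩
  by_contra hlt
  rw [not_le] at hlt
  have h1 := h.coeff_eq_zero hlt
  have h2 : q.coeff w = 0 := by
    by_contra h0
    exact lt_asymm hlt (hq w h0)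
  exact hw (by simp [h1, h2])

theorem uniqueMul (hp : IsLeadingWord p u) (hq : IsLeadingWord q v) :
    UniqueMul p.coeff.support q.coeff.support u v := by
  intro a b ha hb hab
  have ha' := hp.2 a (by simpa using ha)
  have hb' := hq.2 b (by simpa using hb)
  rcases ha'.lt_or_eq with h1 | h1
  · exfalso
    have h2 : wordKey (a * b) < wordKey (u * b) := wordKey_mul_lt_mul_right h1 b
    rcases hb'.lt_or_eq with h3 | h3
    · exact absurd (h2.trans (wordKey_mul_lt_mul_left h3 u)) (by rw [hab]; exact lt_irrefl _)
    · rw [wordKey_injective h3] at h2 hab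
      rw [hab] at h2; exact lt_irrefl _ h2
  · have h1 := wordKey_injective h1
    subst h1
    exact ⟨rfl, mul_left_cancel hab⟩

theorem coeff_mul (hp : IsLeadingWord p u) (hq : IsLeadingWord q v) :
    (p * q).coeff (u * v) = p.coeff u * q.coeff v :=
  MonoidAlgebra.coeff_mul_mul_of_uniqueMul (hp.uniqueMul hq)

theorem mul (hp : IsLeadingWord p u) (hq : IsLeadingWord q v) :
    IsLeadingWord (p * q) (u * v) := by
  classical
  refine ⟨by rw [hp.coeff_mul hq]; exact mul_ne_zero hp.1 hq.1, fun w hw => ?_⟩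
  have hw' : w ∈ (p * q).coeff.support := by simpa using hw
  obtain ⟨a, ha, b, hb, rfl⟩ := Finset.mem_mul.1 (MonoidAlgebra.support_coeff_mul_subset p q hw')
  have ha' := hp.2 a (by simpa using ha)
  have hb' := hq.2 b (by simpa using hb)
  calc wordKey (a * b) ≤ wordKey (u * b) := by
        rcases ha'.lt_or_eq with h | h
        exacts [(wordKey_mul_lt_mul_right h b).le, by rw [wordKey_injective h]]
    _ ≤ _ := by
        rcases hb'.lt_or_eq with h | h
        exacts [(wordKey_mul_lt_mul_left h u).le, by rw [wordKey_injective h]]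

end IsLeadingWord

variable {K : Type*} [Field K] {a b : MonoidAlgebra K (FreeMonoid α)} {u v : FreeMonoid α}

/-- Substitution of `a, b` into a noncommutative polynomial in two variables. -/
noncomputable abbrev evalPair {A : Type*} [Ring A] [Algebra K A] (a b : A) :
    MonoidAlgebra K (FreeMonoid (Fin 2)) →ₐ[K] A :=
  MonoidAlgebra.lift K A (FreeMonoid (Fin 2)) (FreeMonoid.lift ![a, b])

theorem IsLeadingWord.lift_pair (ha : IsLeadingWord a u) (hb : IsLeadingWord b v)
    (w : FreeMonoid (Fin 2)) :
    IsLeadingWord (FreeMonoid.lift ![a, b] w) (FreeMonoid.lift ![u, v] w) ∧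
    (FreeMonoid.lift ![a, b] w).coeff (FreeMonoid.lift ![u, v] w) =
      FreeMonoid.lift ![a.coeff u, b.coeff v] w := by
  induction w using FreeMonoid.inductionOn' with
  | one =>
    classical
    simp only [map_one, IsLeadingWord, MonoidAlgebra.one_def, MonoidAlgebra.coeff_single]
    refine ⟨⟨by simp, fun w hw => ?_⟩, by simp⟩
    rw [Finsupp.single_apply] at hw
    split_ifs at hw with h
    · rw [h]
    · exact absurd rfl hw
  | of_mul i w ih =>
    simp only [map_mul, FreeMonoid.lift_eval_of]
    have hi : IsLeadingWord (![a, b] i) (![u, v] i) ∧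
        (![a, b] i).coeff (![u, v] i) = ![a.coeff u, b.coeff v] i := by
      fin_cases i
      exacts [⟨ha, rfl⟩, ⟨hb, rfl⟩]
    exact ⟨hi.1.mul ih.1, by rw [hi.1.coeff_mul ih.1, ih.2, hi.2]⟩

/-- If the leading words of `a` and `b` do not commute, then the leading word of `p(a, b)` is the
value at these leading words of some word occurring in `p`. -/
theorem IsLeadingWord.evalPair (ha : IsLeadingWord a u) (hb : IsLeadingWord b v)
    (huv : u * v ≠ v * u) {p : MonoidAlgebra K (FreeMonoid (Fin 2))} (hp : p ≠ 0) :
    ∃ w, p.coeff w ≠ 0 ∧ IsLeadingWord (evalPair a b p) (FreeMonoid.lift ![u, v] w) ∧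
      (_root_.evalPair a b p).coeff (FreeMonoid.lift ![u, v] w) =
        p.coeff w * FreeMonoid.lift ![a.coeff u, b.coeff v] w := by
  have hne : p.coeff.support.Nonempty := by
    rw [Finsupp.support_nonempty_iff]; simpa using hp
  obtain ⟨w, hw, hmax⟩ := p.coeff.support.exists_max_image
    (fun w => wordKey (FreeMonoid.lift ![u, v] w)) hne
  have hsum : ∀ x, (_root_.evalPair a b p).coeff x =
      ∑ w' ∈ p.coeff.support, p.coeff w' * (FreeMonoid.lift ![a, b] w').coeff x := by
    intro x
    rw [_root_.evalPair, MonoidAlgebra.lift_apply, Finsupp.sum, MonoidAlgebra.coeff_sum,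
      Finsupp.finsetSum_apply]
    rfl
  have hw0 : p.coeff w ≠ 0 := by simpa using hw
  have hcoeff : (_root_.evalPair a b p).coeff (FreeMonoid.lift ![u, v] w) =
      p.coeff w * FreeMonoid.lift ![a.coeff u, b.coeff v] w := by
    rw [hsum, Finset.sum_eq_single_of_mem w hw, (ha.lift_pair hb w).2]
    intro w' hw' hne'
    have hlt := lt_of_le_of_ne (hmax w' hw') fun h =>
      hne' (FreeMonoid.lift_pair_injective huv (wordKey_injective h))
    rw [(ha.lift_pair hb w').1.coeff_eq_zero hlt, mul_zero]
  refine ⟨w, hw0, ⟨?_, fun x hx => ?_⟩, hcoeff⟩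
  · rw [hcoeff, ← (ha.lift_pair hb w).2]
    exact mul_ne_zero hw0 (ha.lift_pair hb w).1.1
  · by_contra hlt
    rw [not_le] at hlt
    refine hx ?_
    rw [hsum]
    refine Finset.sum_eq_zero fun w' hw' => ?_
    rw [(ha.lift_pair hb w').1.coeff_eq_zero ((hmax w' hw').trans_lt hlt), mul_zero]

end LeadingWord

section CommutatorPolynomials

open Polynomial

theorem FreeMonoid.lift_single_X (K : Type*) [Field K] (i : Fin 2) (w : FreeMonoid (Fin 2)) :
    ((∀ j ∈ w, j = i) ∧ FreeMonoid.lift (Pi.single i (X : K[X])) w = X ^ w.length) ∨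
    ((∃ j ∈ w, j ≠ i) ∧ FreeMonoid.lift (Pi.single i (X : K[X])) w = 0) := by
  induction w using FreeMonoid.inductionOn' with
  | one => exact Or.inl ⟨fun j hj => absurd hj FreeMonoid.notMem_one, by simp⟩
  | of_mul a w ih =>
    rw [map_mul, FreeMonoid.lift_eval_of]
    by_cases ha : a = i
    · subst ha
      rcases ih with ⟨h1, h2⟩ | ⟨⟨j, hj, hji⟩, h2⟩
      · refine Or.inl ⟨fun j hj => ?_, ?_⟩
        · rcases FreeMonoid.mem_mul.1 hj with hj | hj
          exacts [FreeMonoid.mem_of.1 hj, h1 j hj]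
        · rw [h2, FreeMonoid.length_mul, FreeMonoid.length_of, Pi.single_eq_same, pow_add, pow_one]
      · exact Or.inr ⟨⟨j, FreeMonoid.mem_mul.2 (Or.inr hj), hji⟩, by rw [h2, mul_zero]⟩
    · exact Or.inr ⟨⟨a, FreeMonoid.mem_mul.2 (Or.inl FreeMonoid.mem_of_self), ha⟩,
        by rw [Pi.single_eq_of_ne ha, zero_mul]⟩

theorem exists_mem_ne_of_evalPair_eq_zero {K : Type*} [Field K]
    {p : MonoidAlgebra K (FreeMonoid (Fin 2))}
    (i : Fin 2) (hp : MonoidAlgebra.lift K K[X] _ (FreeMonoid.lift (Pi.single i X)) p = 0)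
    {w : FreeMonoid (Fin 2)} (hw : p.coeff w ≠ 0) : ∃ j ∈ w, j ≠ i := by
  by_contra! hall
  have hrep : ∀ w' : FreeMonoid (Fin 2), (∀ j ∈ w', j = i) → w'.length = w.length → w' = w := by
    intro w' h' hlen
    have h1 : w'.toList = List.replicate w'.length i := List.eq_replicate_iff.2 ⟨rfl, h'⟩
    have h2 : w.toList = List.replicate w.length i := List.eq_replicate_iff.2 ⟨rfl, hall⟩
    exact h1.trans (by rw [hlen]; exact h2.symm)
  apply hw
  have hc := congrArg (fun f : K[X] => f.coeff w.length) hp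
  simp only [MonoidAlgebra.lift_apply, Finsupp.sum, finsetSum_coeff, coeff_smul, coeff_zero,
    smul_eq_mul] at hc
  rw [Finset.sum_eq_single w] at hc
  · rcases FreeMonoid.lift_single_X K i w with ⟨-, h⟩ | ⟨⟨j, hj, hji⟩, -⟩
    · rwa [h, coeff_X_pow_self, mul_one] at hc
    · exact absurd (hall j hj) hji
  · intro w' _ hne
    rcases FreeMonoid.lift_single_X K i w' with ⟨h1, h⟩ | ⟨-, h⟩
    · rw [h, coeff_X_pow, if_neg, mul_zero]
      exact fun hlen => hne (hrep w' h1 hlen.symm)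
    · rw [h, coeff_zero, mul_zero]
  · intro h
    rw [Finsupp.notMem_support_iff.1 h, zero_mul]

theorem mem_of_evalPair_eq_zero {K : Type*} [Field K]
    {p : MonoidAlgebra K (FreeMonoid (Fin 2))} (hp : ∀ f g : K[X], evalPair f g p = 0)
    {w : FreeMonoid (Fin 2)} (hw : p.coeff w ≠ 0) : 0 ∈ w ∧ 1 ∈ w := by
  have h0 : (![(X : K[X]), 0] : Fin 2 → K[X]) = (Pi.single 0 X : Fin 2 → K[X]) := by
    ext i; fin_cases i <;> rfl
  have h1 : (![0, (X : K[X])] : Fin 2 → K[X]) = (Pi.single 1 X : Fin 2 → K[X]) := by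
    ext i; fin_cases i <;> rfl
  obtain ⟨i, hi, hi0⟩ := exists_mem_ne_of_evalPair_eq_zero 0 (h0 ▸ hp X 0) hw
  obtain ⟨j, hj, hj1⟩ := exists_mem_ne_of_evalPair_eq_zero 1 (h1 ▸ hp 0 X) hw
  have hi1 : i = 1 := by omega
  have hj0 : j = 0 := by omega
  exact ⟨hj0 ▸ hj, hi1 ▸ hi⟩

variable (Φ K : Type*) [CommRing Φ] [Field K] [Algebra Φ K]

/-- Noncommutative polynomials over `Φ` in two variables which vanish when the variables take
values in `K[X]`. -/
noncomputable def commutatorPolynomials : Submodule Φ (FreeAlgebra Φ (Fin 2)) where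
  carrier := {p | ∀ f g : K[X], FreeAlgebra.lift Φ ![f, g] p = 0}
  add_mem' hp hq f g := by rw [map_add, hp f g, hq f g, add_zero]
  zero_mem' f g := map_zero _
  smul_mem' c p hp f g := by rw [map_smul, hp f g, smul_zero]

variable {A : Type*} [Ring A] [Algebra Φ A]

/-- The values at `(a, b)` of the commutator polynomials over `Φ`. -/
noncomputable def commutatorValues (a b : A) : Submodule Φ A :=
  (commutatorPolynomials Φ K).map (FreeAlgebra.lift Φ ![a, b]).toLinearMap

variable {Φ K}

theorem mem_commutatorValues {a b q : A} : q ∈ commutatorValues Φ K a b ↔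
    ∃ p ∈ commutatorPolynomials Φ K, FreeAlgebra.lift Φ ![a, b] p = q := Iff.rfl

theorem FreeAlgebra.lift_pair_lift_pair {B : Type*} [Ring B] [Algebra Φ B] (f : B →ₐ[Φ] A)
    (x y : B) (p : FreeAlgebra Φ (Fin 2)) :
    f (FreeAlgebra.lift Φ ![x, y] p) = FreeAlgebra.lift Φ ![f x, f y] p := by
  have h : f.comp (FreeAlgebra.lift Φ ![x, y]) = FreeAlgebra.lift Φ ![f x, f y] := by
    ext i; fin_cases i <;> simp
  exact congrArg (fun φ => φ p) h

theorem commutatorValues_le {a b a' b' : A} {c₁ c₂ d₁ d₂ : Φ} (ha : a' = c₁ • a + c₂ • b)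
    (hb : b' = d₁ • a + d₂ • b) : commutatorValues Φ K a' b' ≤ commutatorValues Φ K a b := by
  rintro q ⟨p, hp, rfl⟩
  let x := FreeAlgebra.ι Φ (X := Fin 2)
  refine ⟨FreeAlgebra.lift Φ ![c₁ • x 0 + c₂ • x 1, d₁ • x 0 + d₂ • x 1] p, fun f g => ?_, ?_⟩
  · rw [FreeAlgebra.lift_pair_lift_pair]
    exact hp _ _
  · simp [FreeAlgebra.lift_pair_lift_pair, ha, hb, x]

variable [Algebra K A] [IsScalarTower Φ K A]

/-- A commutator value over `Φ` of two `K`-linear combinations of `G₁, G₂` is a commutator value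
over `K` of `G₁, G₂`. -/
theorem exists_evalPair_of_mem_commutatorValues {a b q G₁ G₂ : A} {c₁ c₂ d₁ d₂ : K}
    (ha : a = c₁ • G₁ + c₂ • G₂) (hb : b = d₁ • G₁ + d₂ • G₂)
    (hq : q ∈ commutatorValues Φ K a b) :
    ∃ p : MonoidAlgebra K (FreeMonoid (Fin 2)),
      (∀ f g : K[X], evalPair f g p = 0) ∧ evalPair G₁ G₂ p = q := by
  obtain ⟨p, hp, rfl⟩ := hq
  let x := fun i : Fin 2 => MonoidAlgebra.of K _ (FreeMonoid.of i)
  refine ⟨FreeAlgebra.lift Φ ![c₁ • x 0 + c₂ • x 1, d₁ • x 0 + d₂ • x 1] p, fun f g => ?_, ?_⟩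
  · exact (FreeAlgebra.lift_pair_lift_pair ((evalPair f g).restrictScalars Φ) _ _ p).trans (hp _ _)
  · refine (FreeAlgebra.lift_pair_lift_pair ((evalPair G₁ G₂).restrictScalars Φ) _ _ p).trans ?_
    simp [ha, hb, x]

/-- Coefficients of polynomials coming from `Φ` lie in `Φ`. -/
theorem exists_evalPair_with_coeff_of_mem_commutatorValues {a b q : A}
    (hq : q ∈ commutatorValues Φ K a b) :
    ∃ p : MonoidAlgebra K (FreeMonoid (Fin 2)),
      (∀ w, ∃ c : Φ, algebraMap Φ K c = p.coeff w) ∧ evalPair a b p = q := by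
  obtain ⟨p, hp, rfl⟩ := hq
  let x := fun i : Fin 2 => MonoidAlgebra.of K _ (FreeMonoid.of i)
  refine ⟨FreeAlgebra.lift Φ ![x 0, x 1] p, ?_, ?_⟩
  · have h : FreeAlgebra.lift Φ ![x 0, x 1] =
        (MonoidAlgebra.mapAlgHom (FreeMonoid (Fin 2)) (Algebra.ofId Φ K)).comp
        (FreeAlgebra.lift Φ (fun i : Fin 2 => MonoidAlgebra.of Φ _ (FreeMonoid.of i))) := by
      ext i; fin_cases i <;> simp [x]
    intro w
    exact ⟨(FreeAlgebra.lift Φ (fun i : Fin 2 => MonoidAlgebra.of Φ _ (FreeMonoid.of i)) p).coeff w,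
      by rw [h]; simp [Algebra.ofId_apply]⟩
  · refine (FreeAlgebra.lift_pair_lift_pair ((evalPair a b).restrictScalars Φ) _ _ p).trans ?_
    simp [x]

end CommutatorPolynomials

section Tuples

variable {Φ : Type*} [CommRing Φ]

/-- The action of matrices over `Φ` on triples of elements of a `Φ`-module. -/
def tupleAct {A : Type*} [AddCommGroup A] [Module Φ A] (g : Matrix (Fin 3) (Fin 3) Φ)
    (F : Fin 3 → A) : Fin 3 → A := fun i => ∑ j, g i j • F j

theorem tupleAct_mul {A : Type*} [AddCommGroup A] [Module Φ A] (g h : Matrix (Fin 3) (Fin 3) Φ)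
    (F : Fin 3 → A) : tupleAct (g * h) F = tupleAct g (tupleAct h F) := by
  ext i
  simp only [tupleAct, Matrix.mul_apply, Finset.sum_smul, Finset.smul_sum, mul_smul]
  rw [Finset.sum_comm]

theorem tupleAct_one {A : Type*} [AddCommGroup A] [Module Φ A] (F : Fin 3 → A) :
    tupleAct (1 : Matrix (Fin 3) (Fin 3) Φ) F = F := by
  ext i
  simp [tupleAct, Matrix.one_apply]

/-- Add `q` to the first entry of a triple. -/
def addFirst {A : Type*} [Add A] (F : Fin 3 → A) (q : A) : Fin 3 → A := ![F 0 + q, F 1, F 2]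

variable {K : Type*} [Field K] [Algebra Φ K]

theorem exists_row_combination_ne_zero {g : Matrix (Fin 3) (Fin 3) Φ} (hg : IsUnit g)
    {c : Fin 3 → K} (hc : c ≠ 0) : ∃ j, ∑ i, c i * algebraMap Φ K (g i j) ≠ 0 := by
  obtain ⟨h, hgh⟩ := hg.exists_right_inv
  by_contra! hall
  refine hc (funext fun k => ?_)
  have hgh' : g.map (algebraMap Φ K) * h.map (algebraMap Φ K) = 1 := by
    rw [← Matrix.map_mul, hgh, Matrix.map_one _ (map_zero _) (map_one _)]
  have h0 : Matrix.vecMul c (g.map (algebraMap Φ K)) = 0 := by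
    ext j
    simpa [Matrix.vecMul, dotProduct] using hall j
  have h1 := congrArg (fun M => Matrix.vecMul c M k) hgh'
  simpa [← Matrix.vecMul_vecMul, h0] using h1.symm

/-- The triple of free generators. -/
noncomputable def letters (K : Type*) [Field K] (i : Fin 3) :
    MonoidAlgebra K (FreeMonoid (Fin 3)) :=
  MonoidAlgebra.single (FreeMonoid.of i) 1

theorem coeff_linear_form_of (c : Fin 3 → K) (j : Fin 3) :
    (∑ i, c i • letters K i).coeff (FreeMonoid.of j) = c j := by
  classical
  simp [MonoidAlgebra.coeff_sum, Finsupp.finsetSum_apply, letters, Finsupp.single_apply,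
    FreeMonoid.of_injective.eq_iff]

theorem length_of_coeff_linear_form_ne_zero {c : Fin 3 → K} {w : FreeMonoid (Fin 3)}
    (hw : (∑ i, c i • letters K i).coeff w ≠ 0) : w.length = 1 := by
  classical
  rw [FreeMonoid.length_eq_one]
  by_contra! hne
  refine hw ?_
  simp only [MonoidAlgebra.coeff_sum, Finsupp.finsetSum_apply, letters, MonoidAlgebra.coeff_smul,
    MonoidAlgebra.coeff_single, Finsupp.smul_apply]
  exact Finset.sum_eq_zero fun i _ => by rw [Finsupp.single_eq_of_ne (hne i), smul_zero]

theorem tupleAct_apply_algebraMap {A : Type*} [AddCommGroup A] [Module Φ A] [Module K A]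
    [IsScalarTower Φ K A] (g : Matrix (Fin 3) (Fin 3) Φ) (F : Fin 3 → A) (i : Fin 3) :
    tupleAct g F i = ∑ j, algebraMap Φ K (g i j) • F j := by
  simp [tupleAct]

/-- The last two entries of `F` span the same plane as two elements with non-commuting leading
words `u` and `v`, and the first entry only involves words shorter than `uv`. -/
def IsReady (F : Fin 3 → MonoidAlgebra K (FreeMonoid (Fin 3))) : Prop :=
  ∃ (G₁ G₂ : MonoidAlgebra K (FreeMonoid (Fin 3))) (u v : FreeMonoid (Fin 3)) (a b c d : K),
    IsLeadingWord G₁ u ∧ IsLeadingWord G₂ v ∧ u * v ≠ v * u ∧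
    F 1 = a • G₁ + b • G₂ ∧ F 2 = c • G₁ + d • G₂ ∧ a * d - b * c ≠ 0 ∧
    ∀ w, (F 0).coeff w ≠ 0 → w.length < u.length + v.length

/-- The leading word of the first entry of `F` is larger than, and does not commute with, the
leading words of nontrivial combinations of the other entries. -/
def IsDominated (F : Fin 3 → MonoidAlgebra K (FreeMonoid (Fin 3))) (t : FreeMonoid (Fin 3)) :
    Prop :=
  IsLeadingWord (F 0) t ∧ ∀ β γ : K, (β ≠ 0 ∨ γ ≠ 0) →
    ∃ v, IsLeadingWord (β • F 1 + γ • F 2) v ∧ wordKey v < wordKey t ∧ v * t ≠ t * v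

theorem IsDominated.wordKey_lt {F : Fin 3 → MonoidAlgebra K (FreeMonoid (Fin 3))}
    {t : FreeMonoid (Fin 3)} (h : IsDominated F t) (β γ : K) {w : FreeMonoid (Fin 3)}
    (hw : (β • F 1 + γ • F 2).coeff w ≠ 0) : wordKey w < wordKey t := by
  have hne : β ≠ 0 ∨ γ ≠ 0 := by
    by_contra! h0
    simp [h0.1, h0.2] at hw
  obtain ⟨v, hv, hlt, -⟩ := h.2 β γ hne
  exact (hv.2 w hw).trans_lt hlt

theorem isReady_tupleAct_letters {g : Matrix (Fin 3) (Fin 3) Φ} (hg : IsUnit g) :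
    IsReady (tupleAct g (letters K)) := by
  set c : Fin 3 → Fin 3 → K := fun i j => algebraMap Φ K (g i j) with hc
  have hF : ∀ i, tupleAct g (letters K) i = ∑ j, c i j • letters K j :=
    fun i => tupleAct_apply_algebraMap g _ i
  obtain ⟨j, hj⟩ := exists_row_combination_ne_zero (K := K) hg (c := Pi.single 1 1)
    (by intro h; simpa using congrFun h 1)
  have hL : (∑ j, c 1 j • letters K j) ≠ 0 := by
    intro h
    have h1 := coeff_linear_form_of (c 1) j
    rw [h] at h1
    refine hj ?_
    rw [Fin.sum_univ_three]
    simpa [Pi.single_apply, hc] using h1.symm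
  obtain ⟨u, hu⟩ := IsLeadingWord.exists_of_ne_zero hL
  set r := (∑ j, c 1 j • letters K j).coeff u with hr
  set s := (∑ j, c 2 j • letters K j).coeff u with hs
  have hr0 : r ≠ 0 := hu.1
  set G := ∑ j, (r * c 2 j - s * c 1 j) • letters K j with hG
  have hG' : G = r • (∑ j, c 2 j • letters K j) - s • (∑ j, c 1 j • letters K j) := by
    simp only [hG, Finset.smul_sum, smul_smul, sub_smul, Finset.sum_sub_distrib]
  obtain ⟨j, hj⟩ := exists_row_combination_ne_zero (K := K) hg (c := ![0, -s, r])
    (by intro h; exact hr0 (by simpa using congrFun h 2))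
  have hG0 : G ≠ 0 := by
    intro h
    have h1 := coeff_linear_form_of (fun j => r * c 2 j - s * c 1 j) j
    rw [← hG, h] at h1
    refine hj ?_
    rw [Fin.sum_univ_three]
    have h2 : r * c 2 j - s * c 1 j = 0 := by simpa using h1.symm
    simp only [Matrix.cons_val_zero, Matrix.cons_val_one, Matrix.cons_val]
    linear_combination h2
  obtain ⟨v, hv⟩ := IsLeadingWord.exists_of_ne_zero hG0
  have hne : u ≠ v := by
    rintro rfl
    refine hv.1 ?_
    rw [hG']
    simp only [MonoidAlgebra.coeff_sub, MonoidAlgebra.coeff_smul, Finsupp.sub_apply,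
      Finsupp.smul_apply, smul_eq_mul, ← hr, ← hs]
    ring
  have hul := length_of_coeff_linear_form_ne_zero hu.1
  have hvl := length_of_coeff_linear_form_ne_zero hv.1
  refine ⟨_, _, u, v, 1, 0, s / r, 1 / r, hu, hv, ?_, ?_, ?_, ?_, ?_⟩
  · obtain ⟨i, rfl⟩ := FreeMonoid.length_eq_one.1 hul
    obtain ⟨k, rfl⟩ := FreeMonoid.length_eq_one.1 hvl
    intro h
    have h' : [i, k] = [k, i] := h
    simp only [List.cons.injEq] at h'
    exact hne (by rw [h'.1])
  · rw [hF, one_smul, zero_smul, add_zero]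
  · rw [hF, hG', smul_sub, smul_smul, smul_smul, one_div, inv_mul_cancel₀ hr0, one_smul,
      div_eq_inv_mul]
    abel
  · simpa using hr0
  · intro w hw
    rw [hF] at hw
    rw [length_of_coeff_linear_form_ne_zero hw, hul, hvl]
    norm_num

theorem IsDominated.isLeadingWord_tupleAct [FaithfulSMul Φ K]
    {F : Fin 3 → MonoidAlgebra K (FreeMonoid (Fin 3))}
    {t : FreeMonoid (Fin 3)} (h : IsDominated F t) {g : Matrix (Fin 3) (Fin 3) Φ} {i : Fin 3}
    (hi : g i 0 ≠ 0) : IsLeadingWord (tupleAct g F i) t := by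
  rw [tupleAct_apply_algebraMap (K := K), Fin.sum_univ_three, add_assoc]
  refine (h.1.smul ?_).add_of_lt fun w hw => h.wordKey_lt _ _ hw
  simpa using hi

theorem IsDominated.wordKey_le_of_tupleAct [FaithfulSMul Φ K]
    {F : Fin 3 → MonoidAlgebra K (FreeMonoid (Fin 3))}
    {t : FreeMonoid (Fin 3)} (h : IsDominated F t) (g : Matrix (Fin 3) (Fin 3) Φ) (i : Fin 3)
    {w : FreeMonoid (Fin 3)} (hw : (tupleAct g F i).coeff w ≠ 0) : wordKey w ≤ wordKey t := by
  by_cases hi : g i 0 = 0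
  · rw [tupleAct_apply_algebraMap (K := K), Fin.sum_univ_three, add_assoc, hi, map_zero, zero_smul,
      zero_add] at hw
    exact (h.wordKey_lt _ _ hw).le
  · exact (h.isLeadingWord_tupleAct hi).2 w hw

theorem IsDominated.isReady [FaithfulSMul Φ K]
    {F : Fin 3 → MonoidAlgebra K (FreeMonoid (Fin 3))}
    {t : FreeMonoid (Fin 3)} (h : IsDominated F t) {g : Matrix (Fin 3) (Fin 3) Φ} (hg : IsUnit g)
    (hg0 : g 1 0 ≠ 0 ∨ g 2 0 ≠ 0) : IsReady (tupleAct g F) := by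
  set c : Fin 3 → Fin 3 → K := fun i j => algebraMap Φ K (g i j) with hc
  have hF : ∀ i, tupleAct g F i = c i 0 • F 0 + c i 1 • F 1 + c i 2 • F 2 := fun i => by
    rw [tupleAct_apply_algebraMap (K := K), Fin.sum_univ_three]
  have hc0 : ∀ i, g i 0 ≠ 0 → c i 0 ≠ 0 := fun i hi => by simpa [hc] using hi
  set β := c 2 0 * c 1 1 - c 1 0 * c 2 1
  set γ := c 2 0 * c 1 2 - c 1 0 * c 2 2
  have hG : c 2 0 • tupleAct g F 1 - c 1 0 • tupleAct g F 2 = β • F 1 + γ • F 2 := by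
    rw [hF, hF]; module
  have hβγ : β ≠ 0 ∨ γ ≠ 0 := by
    obtain ⟨j, hj⟩ := exists_row_combination_ne_zero (K := K) hg (c := ![0, c 2 0, -c 1 0]) (by
      intro h0
      rcases hg0 with h1 | h1
      · exact hc0 1 h1 (by simpa using congrFun h0 2)
      · exact hc0 2 h1 (by simpa using congrFun h0 1))
    rw [Fin.sum_univ_three] at hj
    simp only [Matrix.cons_val_zero, Matrix.cons_val_one, Matrix.cons_val, zero_mul,
      zero_add] at hj
    by_contra! h0
    refine hj ?_
    fin_cases j
    · change c 2 0 * c 1 0 + -c 1 0 * c 2 0 = 0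
      ring
    · refine Eq.trans ?_ h0.1
      change c 2 0 * c 1 1 + -c 1 0 * c 2 1 = _
      ring
    · refine Eq.trans ?_ h0.2
      change c 2 0 * c 1 2 + -c 1 0 * c 2 2 = _
      ring
  obtain ⟨v, hv, hvt, hcomm⟩ := h.2 β γ hβγ
  rw [← hG] at hv
  have hvl : 0 < v.length := by
    rw [Nat.pos_iff_ne_zero, Ne, FreeMonoid.length_eq_zero]
    rintro rfl
    simp at hcomm
  have hlen : ∀ w, (tupleAct g F 0).coeff w ≠ 0 → w.length < t.length + v.length := fun w hw => by
    have := length_le_of_wordKey_le (h.wordKey_le_of_tupleAct g 0 hw)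
    omega
  by_cases h1 : g 1 0 = 0
  · have h2 : g 2 0 ≠ 0 := by tauto
    have h2' := hc0 2 h2
    refine ⟨_, _, t, v, c 1 0 / c 2 0, 1 / c 2 0, 1, 0, h.isLeadingWord_tupleAct h2, hv,
      hcomm.symm, ?_, by simp, by simpa using h2', hlen⟩
    match_scalars <;> field_simp
    ring
  · have h1' := hc0 1 h1
    refine ⟨_, _, t, v, 1, 0, c 2 0 / c 1 0, -(1 / c 1 0), h.isLeadingWord_tupleAct h1, hv,
      hcomm.symm, by simp, ?_, by simpa using h1', hlen⟩
    match_scalars <;> field_simp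
    ring

theorem IsReady.exists_isDominated {F : Fin 3 → MonoidAlgebra K (FreeMonoid (Fin 3))}
    (h : IsReady F) {q : MonoidAlgebra K (FreeMonoid (Fin 3))}
    (hq : q ∈ commutatorValues Φ K (F 1) (F 2)) (hq0 : q ≠ 0) :
    ∃ t, IsDominated (addFirst F q) t ∧ IsLeadingWord q t ∧ (F 0).coeff t = 0 := by
  obtain ⟨G₁, G₂, u, v, a, b, c, d, hu, hv, huv, h1, h2, hdet, hlen⟩ := h
  obtain ⟨p, hp, rfl⟩ := exists_evalPair_of_mem_commutatorValues h1 h2 hq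
  have hp0 : p ≠ 0 := by rintro rfl; simp at hq0
  obtain ⟨w, hw, hlead, -⟩ := hu.evalPair hv huv hp0
  obtain ⟨hw0, hw1⟩ := mem_of_evalPair_eq_zero hp hw
  have hwl := FreeMonoid.length_add_le_of_mem u v hw0 hw1
  have hul : 0 < u.length := by
    rw [Nat.pos_iff_ne_zero, Ne, FreeMonoid.length_eq_zero]
    rintro rfl
    simp at huv
  have hvl : 0 < v.length := by
    rw [Nat.pos_iff_ne_zero, Ne, FreeMonoid.length_eq_zero]
    rintro rfl
    simp at huv
  have hF0 : ∀ x, (F 0).coeff x ≠ 0 → wordKey x < wordKey (FreeMonoid.lift ![u, v] w) :=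
    fun x hx => wordKey_lt_of_length_lt ((hlen x hx).trans_le hwl)
  have hcomm : ∀ i, FreeMonoid.lift ![u, v] (FreeMonoid.of i) * FreeMonoid.lift ![u, v] w ≠
      FreeMonoid.lift ![u, v] w * FreeMonoid.lift ![u, v] (FreeMonoid.of i) := by
    intro i hi
    rw [← map_mul, ← map_mul] at hi
    have hall := FreeMonoid.not_mem_of_commute_of (FreeMonoid.lift_pair_injective huv hi).symm
    have := (hall 0 hw0).trans (hall 1 hw1).symm
    exact absurd this (by decide)
  have hu' : wordKey u < wordKey (FreeMonoid.lift ![u, v] w) :=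
    wordKey_lt_of_length_lt (by omega)
  have hv' : wordKey v < wordKey (FreeMonoid.lift ![u, v] w) :=
    wordKey_lt_of_length_lt (by omega)
  have hadd : addFirst F (_root_.evalPair G₁ G₂ p) 0 = _root_.evalPair G₁ G₂ p + F 0 :=
    add_comm _ _
  refine ⟨_, ⟨hadd ▸ hlead.add_of_lt hF0, fun β γ hβγ => ?_⟩, hlead, ?_⟩
  · change ∃ x, IsLeadingWord (β • F 1 + γ • F 2) x ∧ _
    have hcomb : β • F 1 + γ • F 2 = (β * a + γ * c) • G₁ + (β * b + γ * d) • G₂ := by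
      rw [h1, h2]; module
    rw [hcomb]
    have hne : ¬ (β * a + γ * c = 0 ∧ β * b + γ * d = 0) := by
      rintro ⟨e1, e2⟩
      rcases hβγ with hβ | hγ
      · exact mul_ne_zero hβ hdet (by linear_combination d * e1 - c * e2)
      · exact mul_ne_zero hγ hdet (by linear_combination a * e2 - b * e1)
    by_cases e1 : β * a + γ * c = 0
    · have e2 : β * b + γ * d ≠ 0 := fun e2 => hne ⟨e1, e2⟩
      rw [e1, zero_smul, zero_add]
      exact ⟨v, hv.smul e2, hv', hcomm 1⟩
    by_cases e2 : β * b + γ * d = 0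
    · rw [e2, zero_smul, add_zero]
      exact ⟨u, hu.smul e1, hu', hcomm 0⟩
    rcases lt_trichotomy (wordKey u) (wordKey v) with hlt | heq | hlt
    · rw [add_comm]
      exact ⟨v, (hv.smul e2).add_of_lt fun x hx => ((hu.smul e1).2 x hx).trans_lt hlt, hv',
        hcomm 1⟩
    · rw [wordKey_injective heq] at huv
      exact absurd rfl huv
    · exact ⟨u, (hu.smul e1).add_of_lt fun x hx => ((hv.smul e2).2 x hx).trans_lt hlt, hu',
        hcomm 0⟩
  · by_contra h0
    exact lt_irrefl _ (hF0 _ h0)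

theorem tupleAct_apply {A : Type*} [AddCommGroup A] [Module Φ A] (g : Matrix (Fin 3) (Fin 3) Φ)
    (F : Fin 3 → A) (i : Fin 3) : tupleAct g F i = g i 0 • F 0 + g i 1 • F 1 + g i 2 • F 2 :=
  Fin.sum_univ_three _

/-- Triples obtained from the generators by invertible matrices and by adding nonzero commutator
values to the first entry, where each addition is followed by a matrix which moves the first
entry out of its place. -/
inductive IsReducedTriple (Φ K : Type*) [CommRing Φ] [Field K] [Algebra Φ K] :
    (Fin 3 → MonoidAlgebra K (FreeMonoid (Fin 3))) → Prop
  | linear (g : Matrix (Fin 3) (Fin 3) Φ) (hg : IsUnit g) :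
      IsReducedTriple Φ K (tupleAct g (letters K))
  | step (F : Fin 3 → MonoidAlgebra K (FreeMonoid (Fin 3)))
      (q : MonoidAlgebra K (FreeMonoid (Fin 3))) (g : Matrix (Fin 3) (Fin 3) Φ)
      (hF : IsReducedTriple Φ K F) (hq : q ∈ commutatorValues Φ K (F 1) (F 2)) (hq0 : q ≠ 0)
      (hg : IsUnit g) (hg0 : g 1 0 ≠ 0 ∨ g 2 0 ≠ 0) :
      IsReducedTriple Φ K (tupleAct g (addFirst F q))

theorem IsReducedTriple.isReady [FaithfulSMul Φ K]
    {F : Fin 3 → MonoidAlgebra K (FreeMonoid (Fin 3))}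
    (h : IsReducedTriple Φ K F) : IsReady F := by
  induction h with
  | linear g hg => exact isReady_tupleAct_letters hg
  | step F q g _ hq hq0 hg hg0 ih =>
    obtain ⟨t, ht, -⟩ := ih.exists_isDominated hq hq0
    exact ht.isReady hg hg0

variable (Φ) in
/-- Triples which differ from a reduced one by one addition of a commutator value and one
invertible matrix. -/
def IsTameTriple (F : Fin 3 → MonoidAlgebra K (FreeMonoid (Fin 3))) : Prop :=
  ∃ (F₀ : Fin 3 → MonoidAlgebra K (FreeMonoid (Fin 3))) (q : MonoidAlgebra K (FreeMonoid (Fin 3)))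
    (g : Matrix (Fin 3) (Fin 3) Φ), IsReducedTriple Φ K F₀ ∧
    q ∈ commutatorValues Φ K (F₀ 1) (F₀ 2) ∧ IsUnit g ∧ F = tupleAct g (addFirst F₀ q)

theorem addFirst_zero {A : Type*} [AddMonoid A] (F : Fin 3 → A) : addFirst F 0 = F := by
  ext i; fin_cases i <;> simp [addFirst]

theorem isTameTriple_tupleAct {F : Fin 3 → MonoidAlgebra K (FreeMonoid (Fin 3))}
    (h : IsTameTriple Φ F) {g : Matrix (Fin 3) (Fin 3) Φ} (hg : IsUnit g) :
    IsTameTriple Φ (tupleAct g F) := by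
  obtain ⟨F₀, q, g₀, hF₀, hq, hg₀, rfl⟩ := h
  exact ⟨F₀, q, g * g₀, hF₀, hq, hg.mul hg₀, (tupleAct_mul _ _ _).symm⟩

theorem IsReducedTriple.isTameTriple {F : Fin 3 → MonoidAlgebra K (FreeMonoid (Fin 3))}
    (h : IsReducedTriple Φ K F) : IsTameTriple Φ F :=
  ⟨F, 0, 1, h, zero_mem _, isUnit_one, by rw [addFirst_zero, tupleAct_one]⟩

theorem isTameTriple_letters : IsTameTriple Φ (letters K) := by
  simpa [tupleAct_one] using (IsReducedTriple.linear (K := K) (1 : Matrix (Fin 3) (Fin 3) Φ)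
    isUnit_one).isTameTriple

/-- A tame triple is linear, or ends with the addition of a nonzero commutator value. -/
theorem IsTameTriple.linear_or_exists {F : Fin 3 → MonoidAlgebra K (FreeMonoid (Fin 3))}
    (h : IsTameTriple Φ F) :
    (∃ g : Matrix (Fin 3) (Fin 3) Φ, IsUnit g ∧ F = tupleAct g (letters K)) ∨
    ∃ (F₀ : Fin 3 → MonoidAlgebra K (FreeMonoid (Fin 3)))
      (q : MonoidAlgebra K (FreeMonoid (Fin 3))) (g : Matrix (Fin 3) (Fin 3) Φ),
      IsReducedTriple Φ K F₀ ∧ q ∈ commutatorValues Φ K (F₀ 1) (F₀ 2) ∧ q ≠ 0 ∧ IsUnit g ∧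
      F = tupleAct g (addFirst F₀ q) := by
  obtain ⟨F₀, q, g, hF₀, hq, hg, rfl⟩ := h
  by_cases hq0 : q = 0
  · subst hq0
    rw [addFirst_zero]
    cases hF₀ with
    | linear g₁ hg₁ => exact Or.inl ⟨g * g₁, hg.mul hg₁, (tupleAct_mul _ _ _).symm⟩
    | step F₁ q₁ g₁ hF₁ hq₁ hq₁0 hg₁ _ =>
      exact Or.inr ⟨F₁, q₁, g * g₁, hF₁, hq₁, hq₁0, hg.mul hg₁, (tupleAct_mul _ _ _).symm⟩
  · exact Or.inr ⟨F₀, q, g, hF₀, hq, hq0, hg, rfl⟩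

theorem isTameTriple_addFirst {F : Fin 3 → MonoidAlgebra K (FreeMonoid (Fin 3))}
    (h : IsTameTriple Φ F) {r : MonoidAlgebra K (FreeMonoid (Fin 3))}
    (hr : r ∈ commutatorValues Φ K (F 1) (F 2)) : IsTameTriple Φ (addFirst F r) := by
  have hred : IsReducedTriple Φ K F → IsTameTriple Φ (addFirst F r) := fun hF =>
    ⟨F, r, 1, hF, hr, isUnit_one, (tupleAct_one _).symm⟩
  rcases h.linear_or_exists with ⟨g, hg, rfl⟩ | ⟨F₀, q, g, hF₀, hq, hq0, hg, rfl⟩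
  · exact hred (.linear g hg)
  by_cases hg0 : g 1 0 ≠ 0 ∨ g 2 0 ≠ 0
  · exact hred (.step F₀ q g hF₀ hq hq0 hg hg0)
  push Not at hg0
  obtain ⟨g', hg'⟩ := hg.exists_left_inv
  have h00 : g' 0 0 * g 0 0 = 1 := by
    simpa [Matrix.mul_apply, Fin.sum_univ_three, hg0.1, hg0.2] using congrFun (congrFun hg' 0) 0
  have hr' : r ∈ commutatorValues Φ K (F₀ 1) (F₀ 2) := by
    refine commutatorValues_le (c₁ := g 1 1) (c₂ := g 1 2) (d₁ := g 2 1) (d₂ := g 2 2) ?_ ?_ hr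
    · simp [tupleAct_apply, addFirst, hg0.1]
    · simp [tupleAct_apply, addFirst, hg0.2]
  refine ⟨F₀, q + g' 0 0 • r, g, hF₀, add_mem hq (Submodule.smul_mem _ _ hr'), hg, ?_⟩
  have h00' : g 0 0 • g' 0 0 • r = r := by rw [smul_smul, mul_comm, h00, one_smul]
  ext1 i
  fin_cases i
  · simp only [addFirst, tupleAct_apply, Fin.zero_eta, Matrix.cons_val_zero,
      Matrix.cons_val_one, Matrix.cons_val, smul_add, h00']
    abel
  · simp [addFirst, tupleAct_apply, hg0.1]
  · simp [addFirst, tupleAct_apply, hg0.2]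

theorem tupleAct_permMatrix {A : Type*} [AddCommGroup A] [Module Φ A] (σ : Equiv.Perm (Fin 3))
    (F : Fin 3 → A) : tupleAct (σ.permMatrix Φ) F = F ∘ σ := by
  ext i
  simp [tupleAct, Equiv.Perm.permMatrix, PEquiv.toMatrix_apply, Equiv.toPEquiv_apply]

theorem isUnit_permMatrix (σ : Equiv.Perm (Fin 3)) : IsUnit (σ.permMatrix Φ) := by
  rw [Matrix.isUnit_iff_isUnit_det, Matrix.det_permutation]
  exact (Int.isUnit_iff.2 (Int.isUnit_iff.1 (Units.isUnit _))).map (Int.castRingHom Φ)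

/-- Elementary transformations of a triple at an arbitrary index preserve tameness. -/
theorem IsTameTriple.elementary {F F' : Fin 3 → MonoidAlgebra K (FreeMonoid (Fin 3))}
    (h : IsTameTriple Φ F) (σ : Equiv.Perm (Fin 3)) {α β γ : Φ} (hα : IsUnit α)
    {r : MonoidAlgebra K (FreeMonoid (Fin 3))}
    (hr : r ∈ commutatorValues Φ K (F (σ 1)) (F (σ 2)))
    (h0 : F' (σ 0) = α • F (σ 0) + (β • F (σ 1) + γ • F (σ 2) + r))
    (h1 : F' (σ 1) = F (σ 1)) (h2 : F' (σ 2) = F (σ 2)) : IsTameTriple Φ F' := by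
  have hF : IsTameTriple Φ (F ∘ σ) := tupleAct_permMatrix (Φ := Φ) σ F ▸
    isTameTriple_tupleAct h (isUnit_permMatrix σ)
  have hM : IsUnit !![α, β, γ; 0, 1, 0; 0, 0, 1] := by
    rw [Matrix.isUnit_iff_isUnit_det, Matrix.det_fin_three]
    simpa using hα
  have hF2 := isTameTriple_addFirst (isTameTriple_tupleAct hF hM) (r := r)
    (by simpa [tupleAct_apply] using hr)
  have hF3 := isTameTriple_tupleAct hF2 (isUnit_permMatrix σ.symm)
  rw [tupleAct_permMatrix] at hF3
  convert hF3 using 1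
  rw [Equiv.eq_comp_symm]
  ext1 i
  fin_cases i
  · simp [addFirst, tupleAct_apply, h0, add_assoc]
  · simp [addFirst, tupleAct_apply, h1]
  · simp [addFirst, tupleAct_apply, h2]

end Tuples

section LieHom

attribute [local instance] LieRing.ofAssociativeRing

theorem exists_of_mem_lieSpan_pair {Φ K L A : Type*} [CommRing Φ] [Field K] [Algebra Φ K]
    [LieRing L] [LieAlgebra Φ L] [Ring A] [Algebra Φ A] (θ : L →ₗ⁅Φ⁆ A) {x y f : L}
    (hf : f ∈ LieSubalgebra.lieSpan Φ L {x, y}) :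
    ∃ (β γ : Φ) (r : A), r ∈ commutatorValues Φ K (θ x) (θ y) ∧
      θ f = β • θ x + γ • θ y + r := by
  suffices h : ∃ (P : FreeAlgebra Φ (Fin 2)) (β γ : Φ),
      P - (β • FreeAlgebra.ι Φ 0 + γ • FreeAlgebra.ι Φ 1) ∈ commutatorPolynomials Φ K ∧
      FreeAlgebra.lift Φ ![θ x, θ y] P = θ f by
    obtain ⟨P, β, γ, hP, h⟩ := h
    refine ⟨β, γ, _, mem_commutatorValues.2 ⟨_, hP, rfl⟩, ?_⟩
    simp [h]
  induction hf using LieSubalgebra.lieSpan_induction with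
  | mem w hw =>
    rcases hw with rfl | rfl
    · exact ⟨FreeAlgebra.ι Φ 0, 1, 0, by simp, by simp⟩
    · exact ⟨FreeAlgebra.ι Φ 1, 0, 1, by simp, by simp⟩
  | zero => exact ⟨0, 0, 0, by simp, by simp⟩
  | smul c w _ ih =>
    obtain ⟨P, β, γ, hP, h⟩ := ih
    refine ⟨c • P, c * β, c * γ, ?_, by simp [h]⟩
    convert Submodule.smul_mem _ c hP using 1
    module
  | add w w' _ _ ih ih' =>
    obtain ⟨P, β, γ, hP, h⟩ := ih
    obtain ⟨P', β', γ', hP', h'⟩ := ih'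
    refine ⟨P + P', β + β', γ + γ', ?_, by simp [h, h']⟩
    convert add_mem hP hP' using 1
    module
  | lie w w' _ _ ih ih' =>
    obtain ⟨P, -, -, -, h⟩ := ih
    obtain ⟨P', -, -, -, h'⟩ := ih'
    refine ⟨P * P' - P' * P, 0, 0, fun f g => ?_, ?_⟩
    · simp [mul_comm]
    · simp [h, h', LieRing.of_associative_ring_bracket]

/-- The canonical map from the free Lie algebra to its enveloping free associative algebra. -/
noncomputable def toFreeMonoidAlgebra (Φ K : Type*) [CommRing Φ] [Field K] [Algebra Φ K] :
    FreeLieAlgebra Φ (Fin 3) →ₗ⁅Φ⁆ MonoidAlgebra K (FreeMonoid (Fin 3)) :=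
  FreeLieAlgebra.lift Φ (letters K)

theorem toFreeMonoidAlgebra_xg {Φ K : Type*} [CommRing Φ] [Field K] [Algebra Φ K] (i : Fin 3) :
    toFreeMonoidAlgebra Φ K (xg Φ i) = letters K i :=
  FreeLieAlgebra.lift_of_apply _ _

theorem toFreeMonoidAlgebra_lie {Φ K : Type*} [CommRing Φ] [Field K] [Algebra Φ K]
    (a b : FreeLieAlgebra Φ (Fin 3)) : toFreeMonoidAlgebra Φ K ⁅a, b⁆ =
      toFreeMonoidAlgebra Φ K a * toFreeMonoidAlgebra Φ K b -
        toFreeMonoidAlgebra Φ K b * toFreeMonoidAlgebra Φ K a := by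
  rw [LieHom.map_lie, LieRing.of_associative_ring_bracket]

/-- The triple of images of the generators under an automorphism. -/
noncomputable def autTriple {Φ : Type*} (K : Type*) [CommRing Φ] [Field K] [Algebra Φ K]
    (φ : FreeLieAlgebra Φ (Fin 3) ≃ₗ⁅Φ⁆ FreeLieAlgebra Φ (Fin 3)) (i : Fin 3) :
    MonoidAlgebra K (FreeMonoid (Fin 3)) :=
  toFreeMonoidAlgebra Φ K (φ (xg Φ i))

theorem setOf_ne_eq_image_swap (i : Fin 3) :
    {j | j ≠ i} = {Equiv.swap 0 i 1, Equiv.swap 0 i 2} := by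
  ext j
  simp only [Set.mem_ofPred_eq, Set.mem_insert_iff, Set.mem_singleton_iff]
  revert i j
  decide

variable {Φ K : Type*} [CommRing Φ] [Field K] [Algebra Φ K]

/-- The images of the generators under `φ` and `φ * ψ`, with `ψ` elementary, differ by an
elementary transformation. -/
theorem exists_autTriple_mul_elementary
    (φ : FreeLieAlgebra Φ (Fin 3) ≃ₗ⁅Φ⁆ FreeLieAlgebra Φ (Fin 3))
    {ψ : FreeLieAlgebra Φ (Fin 3) ≃ₗ⁅Φ⁆ FreeLieAlgebra Φ (Fin 3)} (hψ : IsElementaryAut Φ ψ) :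
    ∃ (σ : Equiv.Perm (Fin 3)) (α β γ : Φ) (r : MonoidAlgebra K (FreeMonoid (Fin 3))),
      IsUnit α ∧ r ∈ commutatorValues Φ K (autTriple K φ (σ 1)) (autTriple K φ (σ 2)) ∧
      autTriple K (φ * ψ) (σ 0) = α • autTriple K φ (σ 0) +
        (β • autTriple K φ (σ 1) + γ • autTriple K φ (σ 2) + r) ∧
      autTriple K (φ * ψ) (σ 1) = autTriple K φ (σ 1) ∧
      autTriple K (φ * ψ) (σ 2) = autTriple K φ (σ 2) := by
  obtain ⟨i, α, f, hα, hf, hi, hj⟩ := hψ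
  rw [setOf_ne_eq_image_swap, Set.image_pair] at hf
  obtain ⟨β, γ, r, hr, h⟩ := exists_of_mem_lieSpan_pair (K := K)
    ((toFreeMonoidAlgebra Φ K).comp φ.toLieHom) hf
  have hne : ∀ k : Fin 3, k ≠ 0 → Equiv.swap 0 i k ≠ i := fun k hk h0 =>
    hk ((Equiv.swap 0 i).injective (h0.trans (Equiv.swap_apply_left 0 i).symm))
  refine ⟨Equiv.swap 0 i, α, β, γ, r, hα, hr, ?_, ?_, ?_⟩
  · rw [Equiv.swap_apply_left]
    change toFreeMonoidAlgebra Φ K (φ (ψ (xg Φ i))) = _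
    rw [hi, map_add, map_smul, map_add, map_smul]
    exact congrArg _ h
  · change toFreeMonoidAlgebra Φ K (φ (ψ (xg Φ _))) = _
    rw [hj _ (hne 1 (by decide))]
    rfl
  · change toFreeMonoidAlgebra Φ K (φ (ψ (xg Φ _))) = _
    rw [hj _ (hne 2 (by decide))]
    rfl

theorem IsTameAut.isTameTriple {φ : FreeLieAlgebra Φ (Fin 3) ≃ₗ⁅Φ⁆ FreeLieAlgebra Φ (Fin 3)}
    (h : IsTameAut Φ φ) : IsTameTriple Φ (autTriple K φ) := by
  induction h using Subgroup.closure_induction_right with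
  | one =>
    convert isTameTriple_letters (Φ := Φ) (K := K) using 1
    ext1 i
    exact toFreeMonoidAlgebra_xg i
  | mul_right φ _ ψ hψ ih =>
    obtain ⟨σ, α, β, γ, r, hα, hr, h0, h1, h2⟩ := exists_autTriple_mul_elementary (K := K) φ hψ
    exact ih.elementary σ hα hr h0 h1 h2
  | mul_inv_cancel φ _ ψ hψ ih =>
    obtain ⟨σ, α, β, γ, r, hα, hr, h0, h1, h2⟩ :=
      exists_autTriple_mul_elementary (K := K) (φ * ψ⁻¹) hψ
    rw [inv_mul_cancel_right] at h0 h1 h2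
    obtain ⟨α', hα'⟩ := hα.exists_left_inv
    refine ih.elementary σ (α := α') (β := -(α' * β)) (γ := -(α' * γ)) (r := -(α' • r))
      (IsUnit.of_mul_eq_one α hα') ?_ ?_ h1.symm h2.symm
    · rw [h1, h2]
      exact neg_mem (Submodule.smul_mem _ _ hr)
    · have h3 : α' • α • autTriple K (φ * ψ⁻¹) (σ 0) = autTriple K (φ * ψ⁻¹) (σ 0) := by
        rw [smul_smul, hα', one_smul]
      rw [h0, h1, h2, smul_add, h3]
      module

/-- A triple is not tame if the leading word of its first entry is the product of the other two
leading words, with a leading coefficient which is a unit while that of the second entry is not. -/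
theorem not_isTameTriple_of_isLeadingWord [FaithfulSMul Φ K]
    {f : Fin 3 → MonoidAlgebra K (FreeMonoid (Fin 3))}
    {u v : FreeMonoid (Fin 3)} (huv : u * v ≠ v * u) (h0 : IsLeadingWord (f 0) (v * u))
    (h1 : IsLeadingWord (f 1) u) (h2 : IsLeadingWord (f 2) v) {ε z : Φ} (hε : IsUnit ε)
    (hz : ¬ IsUnit z) (h0c : (f 0).coeff (v * u) = algebraMap Φ K ε)
    (h1c : (f 1).coeff u = algebraMap Φ K z) (h2c : (f 2).coeff v = 1) :
    ¬ IsTameTriple Φ f := by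
  have hul : 0 < u.length := by
    rw [Nat.pos_iff_ne_zero, Ne, FreeMonoid.length_eq_zero]
    rintro rfl
    simp at huv
  have hvl : 0 < v.length := by
    rw [Nat.pos_iff_ne_zero, Ne, FreeMonoid.length_eq_zero]
    rintro rfl
    simp at huv
  have hlow : ∀ (b c : K) (w : FreeMonoid (Fin 3)), (b • f 1 + c • f 2).coeff w ≠ 0 →
      wordKey w < wordKey (v * u) := by
    intro b c w hw
    have hw' : (f 1).coeff w ≠ 0 ∨ (f 2).coeff w ≠ 0 := by
      by_contra! h
      simp [h.1, h.2] at hw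
    rcases hw' with hw | hw
    · exact (h1.2 w hw).trans_lt (wordKey_lt_of_length_lt (by simpa using hvl))
    · exact (h2.2 w hw).trans_lt (wordKey_lt_of_length_lt (by simpa using hul))
  have hact : ∀ (g : Matrix (Fin 3) (Fin 3) Φ) (i : Fin 3), tupleAct g f i =
      algebraMap Φ K (g i 0) • f 0 + (algebraMap Φ K (g i 1) • f 1 +
      algebraMap Φ K (g i 2) • f 2) := fun g i => by
    rw [tupleAct_apply_algebraMap (K := K), Fin.sum_univ_three, add_assoc]
  have hlead : ∀ (g : Matrix (Fin 3) (Fin 3) Φ) (i : Fin 3), g i 0 ≠ 0 →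
      IsLeadingWord (tupleAct g f i) (v * u) := fun g i hi => by
    rw [hact]
    exact (h0.smul (by simpa using hi)).add_of_lt (hlow _ _)
  have hcoeff : ∀ (g : Matrix (Fin 3) (Fin 3) Φ) (i : Fin 3),
      (tupleAct g f i).coeff (v * u) = algebraMap Φ K (g i 0 * ε) := fun g i => by
    have : (algebraMap Φ K (g i 1) • f 1 + algebraMap Φ K (g i 2) • f 2).coeff (v * u) = 0 := by
      by_contra h
      exact lt_irrefl _ (hlow _ _ _ h)
    rw [hact, MonoidAlgebra.coeff_add, Finsupp.add_apply, this, add_zero,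
      MonoidAlgebra.coeff_smul, Finsupp.smul_apply, h0c, map_mul, smul_eq_mul]
  intro hf
  rcases hf.linear_or_exists with ⟨g, -, rfl⟩ | ⟨F₀, q, g, hF₀, hq, hq0, hg, hfg⟩
  · have hlen := h0.1
    rw [tupleAct_apply_algebraMap (K := K)] at hlen
    have := length_of_coeff_linear_form_ne_zero hlen
    rw [FreeMonoid.length_mul] at this
    omega
  obtain ⟨g', hg'⟩ := hg.exists_left_inv
  have hF : addFirst F₀ q = tupleAct g' f := by
    rw [hfg, ← tupleAct_mul, hg', tupleAct_one]
  obtain ⟨t, ⟨ht, hdom⟩, hqt, hF₀t⟩ := hF₀.isReady.exists_isDominated hq hq0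
  have htle : wordKey t ≤ wordKey (v * u) := by
    have ht' := ht.1
    by_cases h : g' 0 0 = 0
    · rw [hF, hact, h, map_zero, zero_smul, zero_add] at ht'
      exact (hlow _ _ _ ht').le
    · rw [hF] at ht'
      exact (hlead g' 0 h).2 _ ht'
  rw [hF] at hdom
  have h10 : g' 1 0 = 0 := by
    by_contra h
    obtain ⟨w, hw, hwt, -⟩ := hdom 1 0 (Or.inl one_ne_zero)
    rw [one_smul, zero_smul, add_zero] at hw
    rw [hw.unique (hlead g' 1 h)] at hwt
    exact absurd htle (not_le.2 hwt)
  have h20 : g' 2 0 = 0 := by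
    by_contra h
    obtain ⟨w, hw, hwt, -⟩ := hdom 0 1 (Or.inr one_ne_zero)
    rw [one_smul, zero_smul, zero_add] at hw
    rw [hw.unique (hlead g' 2 h)] at hwt
    exact absurd htle (not_le.2 hwt)
  have hgg' : g * g' = 1 := mul_eq_one_comm.1 hg'
  have h00 : g 0 0 * g' 0 0 = 1 := by
    simpa [Matrix.mul_apply, Fin.sum_univ_three, h10, h20] using congrFun (congrFun hgg' 0) 0
  have hone : (1 : Φ) ≠ 0 := fun h => by
    simpa using congrArg (algebraMap Φ K) h
  have ht0 : t = v * u := by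
    rw [hF] at ht
    exact ht.unique (hlead g' 0 fun h => hone (by rw [← h00, h, mul_zero]))
  have hqc : q.coeff (v * u) = algebraMap Φ K (g' 0 0 * ε) := by
    rw [← hcoeff, ← hF]
    change _ = (F₀ 0 + q).coeff _
    rw [MonoidAlgebra.coeff_add, Finsupp.add_apply, ← ht0, hF₀t, zero_add]
  have hq' : q ∈ commutatorValues Φ K (f 1) (f 2) := by
    refine commutatorValues_le (c₁ := g' 1 1) (c₂ := g' 1 2) (d₁ := g' 2 1) (d₂ := g' 2 2) ?_ ?_ hq
    · refine (congrFun hF 1).trans ?_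
      rw [tupleAct_apply, h10, zero_smul, zero_add]
    · refine (congrFun hF 2).trans ?_
      rw [tupleAct_apply, h20, zero_smul, zero_add]
  obtain ⟨p, hpΦ, rfl⟩ := exists_evalPair_with_coeff_of_mem_commutatorValues hq'
  have hp0 : p ≠ 0 := by rintro rfl; simp at hq0
  obtain ⟨w, -, hlw, hcw⟩ := h1.evalPair h2 huv hp0
  have hw := hlw.unique hqt
  have hw' : w = FreeMonoid.of 1 * FreeMonoid.of 0 := by
    refine FreeMonoid.lift_pair_injective huv (hw.trans ?_)
    simp [ht0]
  rw [hw, ht0, hqc, hw'] at hcw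
  obtain ⟨c, hc⟩ := hpΦ (FreeMonoid.of 1 * FreeMonoid.of 0)
  rw [← hc, map_mul (FreeMonoid.lift _), FreeMonoid.lift_eval_of, FreeMonoid.lift_eval_of] at hcw
  simp only [Matrix.cons_val_zero, Matrix.cons_val_one, h1c, h2c, one_mul, ← map_mul] at hcw
  have hcz := FaithfulSMul.algebraMap_injective Φ K hcw
  refine hz (isUnit_of_mul_isUnit_right (x := c) ?_)
  rw [← hcz]
  exact (IsUnit.of_mul_eq_one (g 0 0) (by rw [mul_comm, h00])).mul hε

end LieHom

section Anick

/-- The noncommutative polynomials all of whose words are smaller than `u`. -/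
def wordsBelow (K : Type*) [Field K] (u : FreeMonoid (Fin 3)) :
    Submodule K (MonoidAlgebra K (FreeMonoid (Fin 3))) where
  carrier := {p | ∀ w, p.coeff w ≠ 0 → wordKey w < wordKey u}
  add_mem' {p q} hp hq w hw := by
    by_cases h : p.coeff w = 0
    · exact hq w fun h' => hw (by simp [h, h'])
    · exact hp w h
  zero_mem' w hw := absurd (by simp) hw
  smul_mem' c p hp w hw := hp w fun h => hw (by simp [h])

theorem single_mem_wordsBelow {K : Type*} [Field K] {u w : FreeMonoid (Fin 3)}
    (h : wordKey w < wordKey u) (c : K) : MonoidAlgebra.single w c ∈ wordsBelow K u := by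
  intro w' hw'
  by_cases hww : w = w'
  · exact hww ▸ h
  · exact absurd (by simp [Finsupp.single_eq_of_ne' hww]) hw'

theorem isLeadingWord_single_add {K : Type*} [Field K] {u : FreeMonoid (Fin 3)} {c : K}
    (hc : c ≠ 0) {q : MonoidAlgebra K (FreeMonoid (Fin 3))} (hq : q ∈ wordsBelow K u) :
    IsLeadingWord (MonoidAlgebra.single u c + q) u ∧
      (MonoidAlgebra.single u c + q).coeff u = c := by
  have hqu : q.coeff u = 0 := by
    by_contra h
    exact lt_irrefl _ (hq u h)
  refine ⟨IsLeadingWord.add_of_lt ⟨by simpa using hc, fun w hw => ?_⟩ hq, by simp [hqu]⟩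
  by_cases h : u = w
  · rw [h]
  · exact absurd (by simp [Finsupp.single_eq_of_ne' h]) hw

end Anick

/-- Let `Φ` be a Euclidean ring and `z ∈ Φ` a nonzero non-unit.  The automorphism
`δ = (x₁ + [z x₁ − [x₂,x₃], x₃], x₂ + z(z x₁ − [x₂,x₃]), x₃)` of the free Lie
algebra `L₃(Φ) = L_Φ⟨x₁,x₂,x₃⟩` is wild: it does not belong to the subgroup
generated by the elementary automorphisms. -/
theorem anick_automorphism_is_wild
    (Φ : Type*) [CommRing Φ] [IsDomain Φ] (E : EuclideanRingStruct Φ)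
    (z : Φ) (hz : z ≠ 0) (hzu : ¬ IsUnit z)
    (ψ : FreeLieAlgebra Φ (Fin 3) ≃ₗ⁅Φ⁆ FreeLieAlgebra Φ (Fin 3))
    (h1 : ψ (xg Φ 0) = xg Φ 0 + ⁅z • xg Φ 0 - ⁅xg Φ 1, xg Φ 2⁆, xg Φ 2⁆)
    (h2 : ψ (xg Φ 1) = xg Φ 1 + z • (z • xg Φ 0 - ⁅xg Φ 1, xg Φ 2⁆))
    (h3 : ψ (xg Φ 2) = xg Φ 2) :
    ¬ IsTameAut Φ ψ := by
  intro htame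
  let K := FractionRing Φ
  have htriple := htame.isTameTriple (K := K)
  let x : Fin 3 → FreeMonoid (Fin 3) := FreeMonoid.of
  have hx : ∀ i, toFreeMonoidAlgebra Φ K (xg Φ i) = MonoidAlgebra.single (x i) 1 := fun i =>
    toFreeMonoidAlgebra_xg i
  have hzK : algebraMap Φ K z ≠ 0 := by simpa using hz
  have hsmul : ∀ y : MonoidAlgebra K (FreeMonoid (Fin 3)), z • y = algebraMap Φ K z • y := by
    simp
  have e0 : autTriple K ψ 0 = MonoidAlgebra.single (x 2 * (x 2 * x 1)) (-1) +
      (MonoidAlgebra.single (x 0) 1 + MonoidAlgebra.single (x 0 * x 2) (algebraMap Φ K z) +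
        MonoidAlgebra.single (x 2 * x 0) (-algebraMap Φ K z) +
        MonoidAlgebra.single (x 1 * x 2 * x 2) (-1) +
        MonoidAlgebra.single (x 2 * x 1 * x 2) 2) := by
    simp only [autTriple, h1, map_add, toFreeMonoidAlgebra_lie, map_sub, map_smul, hx,
      hsmul, MonoidAlgebra.smul_single, smul_eq_mul, mul_one,
      sub_mul, mul_sub, MonoidAlgebra.single_mul_single, one_mul, mul_assoc]
    simp only [MonoidAlgebra.single_neg, ← one_add_one_eq_two, MonoidAlgebra.single_add]
    abel
  have e1 : autTriple K ψ 1 = MonoidAlgebra.single (x 2 * x 1) (algebraMap Φ K z) +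
      (MonoidAlgebra.single (x 1) 1 +
        MonoidAlgebra.single (x 0) (algebraMap Φ K z * algebraMap Φ K z) +
        MonoidAlgebra.single (x 1 * x 2) (-algebraMap Φ K z)) := by
    simp only [autTriple, h2, map_add, toFreeMonoidAlgebra_lie, map_sub, map_smul, hx,
      hsmul, MonoidAlgebra.smul_single, smul_eq_mul, mul_one,
      smul_sub, MonoidAlgebra.single_mul_single]
    simp only [MonoidAlgebra.single_neg]
    abel
  have e2 : autTriple K ψ 2 = MonoidAlgebra.single (x 2) 1 := by rw [autTriple, h3, hx]
  have l0 := isLeadingWord_single_add (u := x 2 * (x 2 * x 1))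
    (neg_ne_zero.2 (one_ne_zero (α := K)))
    (q := MonoidAlgebra.single (x 0) 1 + MonoidAlgebra.single (x 0 * x 2) (algebraMap Φ K z) +
        MonoidAlgebra.single (x 2 * x 0) (-algebraMap Φ K z) +
        MonoidAlgebra.single (x 1 * x 2 * x 2) (-1) +
        MonoidAlgebra.single (x 2 * x 1 * x 2) 2)
    (by
      refine add_mem (add_mem (add_mem (add_mem ?_ ?_) ?_) ?_) ?_ <;>
        exact single_mem_wordsBelow (wordKey_lt_iff.2 (by decide)) _)
  have l1 := isLeadingWord_single_add (u := x 2 * x 1) hzK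
    (q := MonoidAlgebra.single (x 1) 1 +
        MonoidAlgebra.single (x 0) (algebraMap Φ K z * algebraMap Φ K z) +
        MonoidAlgebra.single (x 1 * x 2) (-algebraMap Φ K z))
    (by
      refine add_mem (add_mem ?_ ?_) ?_ <;>
        exact single_mem_wordsBelow (wordKey_lt_iff.2 (by decide)) _)
  have l2 := isLeadingWord_single_add (u := x 2) (one_ne_zero (α := K)) (zero_mem _)
  rw [← e0] at l0
  rw [← e1] at l1
  rw [add_zero, ← e2] at l2
  exact not_isTameTriple_of_isLeadingWord (u := x 2 * x 1) (v := x 2)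
    (show ([2, 1, 2] : List (Fin 3)) ≠ [2, 2, 1] by decide) l0.1 l1.1 l2.1
    isUnit_one.neg hzu (by simpa using l0.2) l1.2 l2.2 htriple
end

section
/- Let Φ be a Euclidean ring and let z ∈ Φ be a nonzero non-unit. In the free Lie algebra L_3(Φ) = L_Φ⟨x_1,x_2,x_3⟩, the element [[x_2,x_3],x_3] does not belong to the subalgebra generated by z[x_2,x_3] and x_3. -/
attribute [local instance] LieRing.ofAssociativeRing

/-- Diagonal matrices form a Lie subalgebra of all square matrices. -/
def diagonalLieSubalgebra (R A : Type*) {n : Type*} [Fintype n] [DecidableEq n] [CommRing R]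
    [CommRing A] [Algebra R A] : LieSubalgebra R (Matrix n n A) where
  carrier := {M | M.IsDiag}
  add_mem' hM hN := hM.add hN
  zero_mem' := Matrix.isDiag_zero
  smul_mem' c _ hM := hM.smul c
  lie_mem' := by
    rintro M N hM hN
    rw [Set.mem_ofPred_eq, ← hM.diagonal_diag, ← hN.diagonal_diag, Ring.lie_def,
      Matrix.diagonal_mul_diagonal, Matrix.diagonal_mul_diagonal]
    exact (Matrix.isDiag_diagonal _).sub (Matrix.isDiag_diagonal _)

/-- Let `Φ` be a Euclidean ring and `z ∈ Φ` a nonzero non-unit.  In the free Lie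
algebra `L₃(Φ) = L_Φ⟨x₁,x₂,x₃⟩`, the element `[[x₂,x₃],x₃]` does not belong to the
subalgebra generated by `z[x₂,x₃]` and `x₃`. -/
theorem bracket_not_mem_subalgebra
    (Φ : Type*) [CommRing Φ] [IsDomain Φ] (E : EuclideanRingStruct Φ)
    (z : Φ) (hz : z ≠ 0) (hzu : ¬ IsUnit z) :
    ⁅⁅FreeLieAlgebra.of Φ (1 : Fin 3), FreeLieAlgebra.of Φ (2 : Fin 3)⁆,
        FreeLieAlgebra.of Φ (2 : Fin 3)⁆ ∉
      LieSubalgebra.lieSpan Φ (FreeLieAlgebra Φ (Fin 3))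
        {z • ⁅FreeLieAlgebra.of Φ (1 : Fin 3), FreeLieAlgebra.of Φ (2 : Fin 3)⁆,
          FreeLieAlgebra.of Φ (2 : Fin 3)} := by
  intro hmem
  let Q := Φ ⧸ Ideal.span {z}
  have hzQ : algebraMap Φ Q z = 0 :=
    Ideal.Quotient.eq_zero_iff_mem.mpr (Ideal.mem_span_singleton_self z)
  have : Nontrivial Q :=
    Ideal.Quotient.nontrivial_iff.mpr (mt Ideal.span_singleton_eq_top.mp hzu)
  let x := FreeLieAlgebra.of Φ (1 : Fin 3)
  let y := FreeLieAlgebra.of Φ (2 : Fin 3)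
  let f : FreeLieAlgebra Φ (Fin 3) →ₗ⁅Φ⁆ Matrix (Fin 2) (Fin 2) Q :=
    FreeLieAlgebra.lift Φ ![0, !![0, 1; 0, 0], !![0, 0; 0, 1]]
  have hf₁ : f x = !![0, 1; 0, 0] := FreeLieAlgebra.lift_of_apply ..
  have hf₂ : f y = !![0, 0; 0, 1] := FreeLieAlgebra.lift_of_apply ..
  have key : f ⁅x, y⁆ = !![0, 1; 0, 0] := by
    rw [LieHom.map_lie, hf₁, hf₂, Ring.lie_def]
    simp
  have hspan : LieSubalgebra.lieSpan Φ _ {z • ⁅x, y⁆, y} ≤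
      (diagonalLieSubalgebra Φ Q).comap f := by
    rw [LieSubalgebra.lieSpan_le]
    rintro _ (rfl | rfl)
    · have h0 : f (z • ⁅x, y⁆) = 0 := by
        rw [map_smul, ← algebraMap_smul Q z, hzQ, zero_smul]
      change Matrix.IsDiag (f _)
      rw [h0]
      exact Matrix.isDiag_zero
    · change Matrix.IsDiag (f _)
      rw [hf₂]
      intro i j hij
      fin_cases i <;> fin_cases j <;> simp at hij ⊢
  have hdiag : Matrix.IsDiag (f ⁅⁅x, y⁆, y⁆) := hspan hmem
  have h01 := hdiag (show (0 : Fin 2) ≠ 1 by decide)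
  rw [LieHom.map_lie, key, hf₂, Ring.lie_def] at h01
  simp at h01
end
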